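/- Let R be a commutative noetherian ring and I an ideal of R such that the maximal spectrum Max(R) (with the Zariski topology) is the disjoint union of the closed subset V(I) = {m ∈ Max(R) : I ⊆ m} and finitely many irreducible closed subsets V_1, …, V_k, each of which is a noetherian topological space of Krull dimension at most d. Let n ≥ 3 with d ≤ 2n − 3, and let v, w ∈ Um_n(R, I). Then there exist ε_1, ε_2 ∈ E_n(R, I) and elements a, b, a_2, …, a_n ∈ R such that v·ε_1 = (a, a_2, …, a_n) and w·ε_2 = (b, a_2, …, a_n). -/

import Mathlib

open Matrix

/-- The set of unimodular rows of length `n` over `R`. -/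
def Um (n : ℕ) (R : Type*) [CommRing R] : Set (Fin n → R) :=
  {v | ∃ w : Fin n → R, ∑ i, v i * w i = 1}

/-- The set of unimodular rows of length `n` relative to the ideal `I`:
unimodular rows congruent to `(1, 0, …, 0)` modulo `I`. -/
def UmRel (n : ℕ) (R : Type*) [CommRing R] (I : Ideal R) : Set (Fin n → R) :=
  {v | v ∈ Um n R ∧ ∀ i : Fin n, if i.val = 0 then v i - 1 ∈ I else v i ∈ I}

/-- The elementary subgroup `E_n(R)` of `GL_n(R)`, generated by the elementary
matrices `E_{ij}(c) = 1 + c·e_{ij}`, `i ≠ j` (i.e. transvections). -/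
def Elem (n : ℕ) (R : Type*) [CommRing R] : Subgroup (GL (Fin n) R) :=
  Subgroup.closure {g | ∃ i j : Fin n, i ≠ j ∧ ∃ c : R,
    (g : Matrix (Fin n) (Fin n) R) = Matrix.transvection i j c}

/-- The relative elementary subgroup `E_n(R, I)`: the smallest normal subgroup of
`E_n(R)` containing the matrices `E_{21}(x)`, `x ∈ I`; realized as the subgroup
generated by all `E_n(R)`-conjugates of such matrices. -/
def ElemRel (n : ℕ) (R : Type*) [CommRing R] (I : Ideal R) : Subgroup (GL (Fin n) R) :=
  Subgroup.closure {g | ∃ e ∈ Elem n R, ∃ h : GL (Fin n) R, ∃ i j : Fin n,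
    i.val = 1 ∧ j.val = 0 ∧
    (∃ x ∈ I, (h : Matrix (Fin n) (Fin n) R) = Matrix.transvection i j x) ∧
    g = e * h * e⁻¹}

section Elementary

variable {R : Type*} [CommRing R] {n : ℕ}

/-- The elementary matrix `E_{ij}(c)` as an element of `GL_n(R)`. -/
def elemGL (i j : Fin n) (h : i ≠ j) (c : R) : GL (Fin n) R where
  val := transvection i j c
  inv := transvection i j (-c)
  val_inv := by rw [transvection_mul_transvection_same _ _ h]; simp
  inv_val := by rw [transvection_mul_transvection_same _ _ h]; simp

theorem coe_elemGL (i j : Fin n) (h : i ≠ j) (c : R) :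
    (elemGL i j h c : Matrix (Fin n) (Fin n) R) = transvection i j c := rfl

theorem elemGL_mem_Elem (i j : Fin n) (h : i ≠ j) (c : R) : elemGL i j h c ∈ Elem n R :=
  Subgroup.subset_closure ⟨i, j, h, c, rfl⟩

theorem elemGL_commutator (i j k : Fin n) (hij : i ≠ j) (hjk : j ≠ k) (hik : i ≠ k) (a b : R) :
    elemGL i j hij a * elemGL j k hjk b * (elemGL i j hij a)⁻¹ * (elemGL j k hjk b)⁻¹ =
      elemGL i k hik (a * b) := by
  rw [mul_inv_eq_iff_eq_mul, mul_inv_eq_iff_eq_mul]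
  apply Units.ext
  simp only [Units.val_mul, coe_elemGL, transvection]
  simp [Matrix.add_mul, Matrix.mul_add, hjk.symm, hik.symm]
  abel

theorem conj_mem_ElemRel {I : Ideal R} {e g : GL (Fin n) R} (he : e ∈ Elem n R)
    (hg : g ∈ ElemRel n R I) : e * g * e⁻¹ ∈ ElemRel n R I := by
  induction hg using Subgroup.closure_induction with
  | mem g hg =>
    obtain ⟨e', he', h, i, j, hi, hj, hx, rfl⟩ := hg
    exact Subgroup.subset_closure
      ⟨e * e', mul_mem he he', h, i, j, hi, hj, hx, by group⟩
  | one => simp [one_mem]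
  | mul a b _ _ ha hb =>
    have : e * (a * b) * e⁻¹ = (e * a * e⁻¹) * (e * b * e⁻¹) := by group
    exact this ▸ mul_mem ha hb
  | inv a _ ha =>
    have : e * a⁻¹ * e⁻¹ = (e * a * e⁻¹)⁻¹ := by group
    exact this ▸ inv_mem ha

theorem elemGL_mem_ElemRel_of_right {I : Ideal R} {i j k : Fin n} (hij : i ≠ j) (hjk : j ≠ k)
    (hik : i ≠ k) {x : R} (h : elemGL j k hjk x ∈ ElemRel n R I) :
    elemGL i k hik x ∈ ElemRel n R I := by
  have := elemGL_commutator i j k hij hjk hik 1 x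
  rw [one_mul] at this
  rw [← this]
  exact mul_mem (conj_mem_ElemRel (elemGL_mem_Elem _ _ _ _) h) (inv_mem h)

theorem elemGL_mem_ElemRel_of_left {I : Ideal R} {i j k : Fin n} (hij : i ≠ j) (hjk : j ≠ k)
    (hik : i ≠ k) {x : R} (h : elemGL i j hij x ∈ ElemRel n R I) :
    elemGL i k hik x ∈ ElemRel n R I := by
  have := elemGL_commutator i j k hij hjk hik x 1
  rw [mul_one] at this
  rw [← this, mul_assoc, mul_assoc, ← mul_assoc (elemGL j k hjk 1)]
  exact mul_mem h (conj_mem_ElemRel (elemGL_mem_Elem _ _ _ _) (inv_mem h))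

theorem elemGL_col_zero_mem {s : ℕ} {I : Ideal R} (i : Fin (s + 3)) (hi : i ≠ 0) {x : R}
    (hx : x ∈ I) : elemGL i 0 hi x ∈ ElemRel (s + 3) R I := by
  have h10 : elemGL 1 0 (by simp) x ∈ ElemRel (s + 3) R I :=
    Subgroup.subset_closure ⟨1, one_mem _, elemGL 1 0 (by simp) x, 1, 0, rfl, rfl, ⟨x, hx, rfl⟩, by simp⟩
  by_cases h1 : i = 1
  · subst h1; exact h10
  · exact elemGL_mem_ElemRel_of_right h1 (by simp) hi h10

theorem elemGL_row_zero_mem {s : ℕ} {I : Ideal R} (j : Fin (s + 3)) (hj : 0 ≠ j) {x : R}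
    (hx : x ∈ I) : elemGL 0 j hj x ∈ ElemRel (s + 3) R I := by
  have key : ∀ (j : Fin (s + 3)) (hj : 0 ≠ j), j ≠ 1 → elemGL 0 j hj x ∈ ElemRel (s + 3) R I := by
    intro j hj h1
    exact elemGL_mem_ElemRel_of_right (j := 1) (by simp) h1.symm hj
      (elemGL_mem_ElemRel_of_left (j := 0) (by simp) hj h1.symm (elemGL_col_zero_mem 1 (by simp) hx))
  by_cases h1 : j = 1
  · have h02 : (0 : Fin (s + 3)) ≠ 2 := by simp [Fin.ext_iff, Nat.mod_eq_of_lt]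
    have h21 : (2 : Fin (s + 3)) ≠ 1 := by simp [Fin.ext_iff, Nat.mod_eq_of_lt]
    subst h1
    exact elemGL_mem_ElemRel_of_left h02 h21 hj (key 2 h02 h21)
  · exact key j hj h1

theorem vecMul_elemGL (i j : Fin n) (h : i ≠ j) (c : R) (v : Fin n → R) :
    v ᵥ* (elemGL i j h c : Matrix (Fin n) (Fin n) R) = Function.update v j (v j + c * v i) := by
  rw [coe_elemGL, transvection, vecMul_add, vecMul_one]
  ext k
  by_cases hk : k = j
  · subst hk; simp [vecMul, dotProduct, Matrix.single_apply, mul_comm]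
  · simp [vecMul, dotProduct, hk, Ne.symm hk]

/-- `RelOrbit I v v'` says that `v'` lies in the orbit of the row `v` under `E_n(R, I)`. -/
def RelOrbit (I : Ideal R) (v v' : Fin n → R) : Prop :=
  ∃ ε ∈ ElemRel n R I, v ᵥ* (ε : Matrix (Fin n) (Fin n) R) = v'

theorem RelOrbit.refl (I : Ideal R) (v : Fin n → R) : RelOrbit I v v :=
  ⟨1, one_mem _, by simp⟩

theorem RelOrbit.trans {I : Ideal R} {u v w : Fin n → R} (h : RelOrbit I u v)
    (h' : RelOrbit I v w) : RelOrbit I u w := by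
  obtain ⟨e, he, rfl⟩ := h
  obtain ⟨f, hf, rfl⟩ := h'
  exact ⟨e * f, mul_mem he hf, by simp [vecMul_vecMul]⟩

theorem relOrbit_add_head {s : ℕ} {I : Ideal R} (a : R) (r c : Fin (s + 2) → R)
    (hc : ∀ i, c i ∈ I) :
    RelOrbit I (Fin.cons a r : Fin (s + 3) → R) (Fin.cons a fun i => r i + c i * a) := by
  suffices H : ∀ S : Finset (Fin (s + 2)), RelOrbit I (Fin.cons a r : Fin (s + 3) → R)
      (Fin.cons a fun i => if i ∈ S then r i + c i * a else r i) by
    simpa using H Finset.univ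
  intro S
  induction S using Finset.induction_on with
  | empty => simpa using RelOrbit.refl I _
  | insert k S hk ih =>
    refine ih.trans ⟨_, elemGL_row_zero_mem k.succ (Fin.succ_ne_zero k).symm (hc k), ?_⟩
    rw [vecMul_elemGL]
    ext i
    refine Fin.cases ?_ (fun i => ?_) i
    · simp [Function.update_of_ne (Fin.succ_ne_zero k).symm]
    · by_cases hik : i = k
      · subst hik; simp [hk]
      · simp [hik]

theorem relOrbit_add_tail {s : ℕ} {I : Ideal R} (a : R) (r c : Fin (s + 2) → R)
    (hc : ∀ i, c i ∈ I) :
    RelOrbit I (Fin.cons a r : Fin (s + 3) → R) (Fin.cons (a + ∑ i, c i * r i) r) := by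
  suffices H : ∀ S : Finset (Fin (s + 2)), RelOrbit I (Fin.cons a r : Fin (s + 3) → R)
      (Fin.cons (a + ∑ i ∈ S, c i * r i) r) from H Finset.univ
  intro S
  induction S using Finset.induction_on with
  | empty => simpa using RelOrbit.refl I _
  | insert k S hk ih =>
    refine ih.trans ⟨_, elemGL_col_zero_mem k.succ (Fin.succ_ne_zero k) (hc k), ?_⟩
    rw [vecMul_elemGL, Finset.sum_insert hk]
    ext i
    refine Fin.cases ?_ (fun i => ?_) i
    · simp only [Function.update_self, Fin.cons_zero, Fin.cons_succ]; ring
    · simp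

theorem exists_relOrbit_of_isCoprime {s : ℕ} {I : Ideal R} {a b : R} (hab : IsCoprime a b)
    {r r' : Fin (s + 2) → R} (hr : ∀ i, r i ∈ I) (hr' : ∀ i, r' i ∈ I) :
    ∃ z : Fin (s + 2) → R, RelOrbit I (Fin.cons a r : Fin (s + 3) → R) (Fin.cons a z) ∧
      RelOrbit I (Fin.cons b r' : Fin (s + 3) → R) (Fin.cons b z) := by
  obtain ⟨α, β, h⟩ := hab
  refine ⟨_, relOrbit_add_head a r (fun i => (r' i - r i) * α)
    fun i => I.mul_mem_right _ (sub_mem (hr' i) (hr i)), ?_⟩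
  have := relOrbit_add_head b r' (fun i => (r i - r' i) * β)
    fun i => I.mul_mem_right _ (sub_mem (hr i) (hr' i))
  convert this using 3 with i
  linear_combination (r' i - r i) * h

end Elementary

section GeneralPosition

open TopologicalSpace

variable {R : Type*} [CommRing R]

theorem MaximalSpectrum.isClosed_setOf_mem (f : R) :
    IsClosed {m : MaximalSpectrum R | f ∈ m.asIdeal} := by
  have := (PrimeSpectrum.isClosed_zeroLocus {f}).preimage
    (MaximalSpectrum.toPrimeSpectrum_continuous (R := R))
  convert this using 1
  ext m
  simp [MaximalSpectrum.toPrimeSpectrum]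

theorem MaximalSpectrum.mem_of_isClosed_of_iInf_le {Y : Set (MaximalSpectrum R)}
    (hY : IsClosed Y) {m : MaximalSpectrum R} (hm : ⨅ y ∈ Y, y.asIdeal ≤ m.asIdeal) :
    m ∈ Y := by
  obtain ⟨C, hC, rfl⟩ := isClosed_induced_iff.mp hY
  obtain ⟨s, rfl⟩ := (PrimeSpectrum.isClosed_iff_zeroLocus C).mp hC
  intro f hf
  refine hm ?_
  simp only [Ideal.mem_iInf]
  exact fun y hy => hy hf

theorem sup_iInf_eq_top {Y : Set (MaximalSpectrum R)} (hY : IsClosed Y) {K : Ideal R}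
    (hK : ∀ m ∈ Y, ¬ K ≤ m.asIdeal) : K ⊔ ⨅ y ∈ Y, y.asIdeal = ⊤ := by
  by_contra hne
  obtain ⟨M, hM, hle⟩ := Ideal.exists_le_maximal _ hne
  exact hK ⟨M, hM⟩ (MaximalSpectrum.mem_of_isClosed_of_iInf_le hY (le_sup_right.trans hle))
    (le_sup_left.trans hle)

theorem exists_add_mul_notMem (F : Finset (MaximalSpectrum R)) (a g : R)
    (hg : ∀ m ∈ F, g ∉ m.asIdeal) : ∃ t : R, ∀ m ∈ F, a + t * g ∉ m.asIdeal := by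
  classical
  have hcop : Pairwise (Function.onFun IsCoprime fun m : F => m.1.asIdeal) := by
    intro m m' hne
    refine Ideal.isCoprime_iff_sup_eq.mpr
      (m.1.isMaximal.coprime_of_ne m'.1.isMaximal fun h => hne ?_)
    exact Subtype.ext (MaximalSpectrum.ext h)
  obtain ⟨t, ht⟩ := Ideal.exists_forall_sub_mem_ideal hcop
    fun m => if a ∈ m.1.asIdeal then 1 else 0
  refine ⟨t, fun m hm hmem => ?_⟩
  have h := m.asIdeal.mul_mem_right g (ht ⟨m, hm⟩)
  by_cases ha : a ∈ m.asIdeal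
  · simp only [ha, if_true] at h
    refine hg m hm ?_
    have : g = (a + t * g) - a - (t - 1) * g := by ring
    exact this ▸ sub_mem (sub_mem hmem ha) h
  · simp only [ha, if_false] at h
    refine ha ?_
    have : a = (a + t * g) - (t - 0) * g := by ring
    exact this ▸ sub_mem hmem h

theorem exists_card_le_coheight {q : Type*} [Finite q] {ι : Type*}
    (X : q → Set (MaximalSpectrum R)) [∀ j, NoetherianSpace (X j)] (a g : ι → R)
    (hg : ∀ j, ∀ m ∈ X j, ∀ k, g k ∉ m.asIdeal) (S : Finset ι) :
    ∃ t : ι → R, ∀ j, ∀ Z : IrreducibleCloseds (X j),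
      (∀ k ∈ S, ∀ m ∈ Z, a k + t k * g k ∈ m.1.asIdeal) → (S.card : ℕ∞) ≤ Order.coheight Z := by
  classical
  induction S using Finset.induction_on with
  | empty => exact ⟨0, by simp⟩
  | insert k S hk ih =>
    obtain ⟨t, ht⟩ := ih
    have hC : ∀ j, IsClosed {m : X j | ∀ k ∈ S, a k + t k * g k ∈ m.1.asIdeal} := by
      intro j
      simp only [Set.ofPred_forall]
      exact isClosed_biInter fun k _ =>
        (MaximalSpectrum.isClosed_setOf_mem _).preimage continuous_subtype_val
    choose 𝒯 hfin hcl hirr hun using fun j =>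
      NoetherianSpace.exists_finite_set_isClosed_irreducible (hC j)
    have hpt : ∀ j, ∀ T : 𝒯 j, ∃ p : X j, p ∈ T.1 := fun j T => (hirr j T.1 T.2).nonempty
    choose p hp using hpt
    have : ∀ j, Finite (𝒯 j) := fun j => (hfin j).to_subtype
    have hF : (Set.range fun x : Σ j, 𝒯 j => (p x.1 x.2).1).Finite := Set.finite_range _
    obtain ⟨τ, hτ⟩ := exists_add_mul_notMem hF.toFinset (a k) (g k) (by
      intro m hm
      obtain ⟨x, rfl⟩ := hF.mem_toFinset.mp hm
      exact hg x.1 _ (p x.1 x.2).2 k)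
    refine ⟨Function.update t k τ, fun j Z hZ => ?_⟩
    have hZS : (Z : Set (X j)) ⊆ ⋃₀ 𝒯 j := by
      rw [← hun j]
      intro m hm i hi
      have hik : i ≠ k := fun h => hk (h ▸ hi)
      simpa [hik] using hZ i (Finset.mem_insert_of_mem hi) m hm
    obtain ⟨T, hT, hZT⟩ := isIrreducible_iff_sUnion_isClosed.mp Z.isIrreducible (hfin j).toFinset
      (fun T hT => hcl j T ((hfin j).mem_toFinset.mp hT)) (by simpa using hZS)
    rw [Set.Finite.mem_toFinset] at hT
    let T' : IrreducibleCloseds (X j) := ⟨T, hirr j T hT, hcl j T hT⟩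
    have hT' : (S.card : ℕ∞) ≤ Order.coheight T' := by
      refine ht j T' fun i hi m hm => ?_
      have : m ∈ ⋃₀ 𝒯 j := ⟨T, hT, hm⟩
      rw [← hun j] at this
      exact this i hi
    have hlt : Z < T' := by
      refine lt_of_le_of_ne hZT fun h => ?_
      have hpZ : p j ⟨T, hT⟩ ∈ Z := h ▸ hp j ⟨T, hT⟩
      have := hZ k (Finset.mem_insert_self _ _) _ hpZ
      rw [Function.update_self] at this
      exact hτ _ (hF.mem_toFinset.mpr ⟨⟨j, ⟨T, hT⟩⟩, rfl⟩) this
    rw [Finset.card_insert_of_notMem hk, Nat.cast_add, Nat.cast_one]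
    exact (add_le_add_left hT' 1).trans (Order.coheight_add_one_le hlt)

theorem exists_forall_exists_notMem {q : Type*} [Finite q] {ι : Type*} [Fintype ι]
    (X : q → Set (MaximalSpectrum R)) [∀ j, NoetherianSpace (X j)] {d : ℕ}
    (hdim : ∀ j, topologicalKrullDim (X j) ≤ d) (hd : d < Fintype.card ι) (a g : ι → R)
    (hg : ∀ j, ∀ m ∈ X j, ∀ k, g k ∉ m.asIdeal) :
    ∃ t : ι → R, ∀ j, ∀ m ∈ X j, ∃ k, a k + t k * g k ∉ m.asIdeal := by
  obtain ⟨t, ht⟩ := exists_card_le_coheight X a g hg Finset.univ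
  refine ⟨t, fun j m hm => ?_⟩
  by_contra! h
  have h1 := ht j {⟨m, hm⟩} (by
    intro k _ m' hm'
    rw [IrreducibleCloseds.mem_singleton.mp hm']
    exact h k)
  have h2 := (WithBot.coe_le_coe.mpr h1).trans
    ((Order.coheight_le_krullDim _).trans (hdim j))
  rw [Finset.card_univ] at h2
  exact absurd (by exact_mod_cast h2) hd.not_ge

end GeneralPosition

/-- relative Mennicke–Newman, first coordinate: `R` commutative
noetherian, `I` an ideal such that `Max(R)` is the disjoint union of the closed
set `V(I)` and finitely many irreducible closed sets `V₁, …, V_q`, each a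
noetherian topological space of Krull dimension at most `d`, where
`d ≤ 2n − 3` and `n = s + 3 ≥ 3`.  Then any `v, w ∈ Um_n(R, I)` can be moved by
`E_n(R, I)` to rows agreeing except possibly in the first coordinate. -/
theorem relative_mennicke_newman_first
    (R : Type*) [CommRing R] [IsNoetherianRing R]
    (I : Ideal R) (d s q : ℕ)
    (hd : d ≤ 2 * (s + 3) - 3)
    (V : Fin q → Set (MaximalSpectrum R))
    (hclosed : ∀ i, IsClosed (V i))
    (hirr : ∀ i, IsIrreducible (V i))
    (hnoeth : ∀ i, TopologicalSpace.NoetherianSpace (V i))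
    (hdimV : ∀ i, topologicalKrullDim (V i) ≤ (d : WithBot ℕ∞))
    (hcover : (Set.univ : Set (MaximalSpectrum R)) =
      {𝔪 : MaximalSpectrum R | I ≤ 𝔪.asIdeal} ∪ ⋃ i, V i)
    (hdisj0 : ∀ i, Disjoint {𝔪 : MaximalSpectrum R | I ≤ 𝔪.asIdeal} (V i))
    (hdisj : ∀ i j, i ≠ j → Disjoint (V i) (V j))
    (v w : Fin (s + 3) → R)
    (hv : v ∈ UmRel (s + 3) R I) (hw : w ∈ UmRel (s + 3) R I) :
    ∃ ε₁ ∈ ElemRel (s + 3) R I, ∃ ε₂ ∈ ElemRel (s + 3) R I, ∃ b : R,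
      Matrix.vecMul w (ε₂ : Matrix (Fin (s + 3)) (Fin (s + 3)) R) =
        Function.update
          (Matrix.vecMul v (ε₁ : Matrix (Fin (s + 3)) (Fin (s + 3)) R)) 0 b := by
  classical
  set Y : Set (MaximalSpectrum R) := ⋃ i, V i
  have hY : IsClosed Y := isClosed_iUnion_of_finite hclosed
  have hIY : ∀ m ∈ Y, ¬ I ≤ m.asIdeal := by
    intro m hm hIm
    obtain ⟨i, hi⟩ := Set.mem_iUnion.mp hm
    exact Set.disjoint_left.mp (hdisj0 i) hIm hi
  set J : Ideal R := ⨅ y ∈ Y, y.asIdeal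
  have hJle : ∀ m ∈ Y, J ≤ m.asIdeal := fun m hm => iInf₂_le m hm
  have hIJ : I ⊔ J = ⊤ := sup_iInf_eq_top hY hIY
  obtain ⟨x, hxI, y, hyJ, hxy⟩ := Submodule.mem_sup.mp (hIJ ▸ Submodule.mem_top : (1 : R) ∈ I ⊔ J)
  have hx : ∀ m ∈ Y, x ∉ m.asIdeal := fun m hm h =>
    m.isMaximal.ne_top ((Ideal.eq_top_iff_one _).mpr (hxy ▸ add_mem h (hJle m hm hyJ)))
  obtain ⟨⟨v', hv'⟩, hvI⟩ := hv
  obtain ⟨⟨w', hw'⟩, hwI⟩ := hw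
  have hv0 : v 0 - 1 ∈ I := by simpa using hvI 0
  have hw0 : w 0 - 1 ∈ I := by simpa using hwI 0
  have hvs : ∀ i : Fin (s + 2), v i.succ ∈ I := fun i => by simpa using hvI i.succ
  have hws : ∀ i : Fin (s + 2), w i.succ ∈ I := fun i => by simpa using hwI i.succ
  let X : Fin q → Set (MaximalSpectrum R) := fun j =>
    V j ∩ {m | v 0 ∉ m.asIdeal ∧ w 0 ∉ m.asIdeal}
  have hXV : ∀ j, X j ⊆ V j := fun j => Set.inter_subset_left
  have hXnoeth : ∀ j, TopologicalSpace.NoetherianSpace (X j) := fun j =>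
    (Topology.IsEmbedding.inclusion (hXV j)).isInducing.noetherianSpace
  have hXdim : ∀ j, topologicalKrullDim (X j) ≤ d := fun j =>
    (Topology.IsEmbedding.inclusion (hXV j)).isInducing.topologicalKrullDim_le.trans (hdimV j)
  obtain ⟨t, ht⟩ := exists_forall_exists_notMem (ι := Fin (s + 2) ⊕ Fin (s + 2)) X hXdim
    (by simp; omega) (Sum.elim (fun i => v i.succ) fun i => w i.succ)
    (Sum.elim (fun _ => x * v 0) fun _ => x * w 0) (by
      rintro j m ⟨hmV, hmv, hmw⟩ (k | k) h
      all_goals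
        rcases m.isMaximal.isPrime.mem_or_mem h with h | h
        · exact hx m (Set.mem_iUnion.mpr ⟨j, hmV⟩) h
        · contradiction)
  let r : Fin (s + 2) → R := fun i => v i.succ + (t (.inl i) * x) * v 0
  let r' : Fin (s + 2) → R := fun i => w i.succ + (t (.inr i) * x) * w 0
  have hr : ∀ i, r i ∈ I := fun i =>
    add_mem (hvs i) (I.mul_mem_right _ (I.mul_mem_left _ hxI))
  have hr' : ∀ i, r' i ∈ I := fun i =>
    add_mem (hws i) (I.mul_mem_right _ (I.mul_mem_left _ hxI))
  have hunim : ∀ (u u' : Fin (s + 3) → R) (c : Fin (s + 2) → R) (m : MaximalSpectrum R),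
      ∑ i, u i * u' i = 1 → u 0 ∈ m.asIdeal → ¬ ∀ i, u i.succ + c i * u 0 ∈ m.asIdeal := by
    intro u u' c m hu hu0 h
    refine m.isMaximal.ne_top ((Ideal.eq_top_iff_one _).mpr (hu ▸ sum_mem fun i _ => ?_))
    refine m.asIdeal.mul_mem_right _ (Fin.cases hu0 (fun i => ?_) i)
    exact (add_mem_cancel_right (m.asIdeal.mul_mem_left _ hu0)).mp (h i)
  let K : Ideal R := Ideal.span (Set.range (Sum.elim r r'))
  have hKY : ∀ m ∈ Y, ¬ K ≤ m.asIdeal := by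
    intro m hm hKm
    have hmem : ∀ k, Sum.elim r r' k ∈ m.asIdeal := fun k =>
      hKm (Ideal.subset_span (Set.mem_range_self k))
    obtain ⟨j, hj⟩ := Set.mem_iUnion.mp hm
    have hmv : v 0 ∉ m.asIdeal := fun h => hunim v v' _ m hv' h fun i => hmem (.inl i)
    have hmw : w 0 ∉ m.asIdeal := fun h => hunim w w' _ m hw' h fun i => hmem (.inr i)
    obtain ⟨k, hk⟩ := ht j m ⟨hj, hmv, hmw⟩
    refine hk ?_
    rcases k with k | k
    · simpa [r, mul_assoc] using hmem (.inl k)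
    · simpa [r', mul_assoc] using hmem (.inr k)
  have hIKY : ∀ m ∈ Y, ¬ I * K ≤ m.asIdeal := fun m hm h =>
    (m.isMaximal.isPrime.mul_le.mp h).elim (hIY m hm) (hKY m hm)
  obtain ⟨e, heIK, f, hfJ, hef⟩ := Submodule.mem_sup.mp
    (sup_iInf_eq_top hY hIKY ▸ Submodule.mem_top : (1 : R) ∈ I * K ⊔ ⨅ y ∈ Y, y.asIdeal)
  obtain ⟨c, hcI, hc⟩ := (Submodule.mem_ideal_smul_span_iff_exists_sum I _ e).mp heIK
  rw [Finsupp.sum_fintype _ _ (by simp), Fintype.sum_sum_type] at hc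
  simp only [Sum.elim_inl, Sum.elim_inr, smul_eq_mul] at hc
  set z : R := w 0 - v 0 + 1 with hz
  let a : R := v 0 + ∑ i, z * c (.inl i) * r i
  let b : R := w 0 + ∑ i, -z * c (.inr i) * r' i
  have hvr : RelOrbit I v (Fin.cons a r) := by
    have h1 := relOrbit_add_head (v 0) (fun i => v i.succ) (fun i => t (.inl i) * x)
      fun i => I.mul_mem_left _ hxI
    rw [show (Fin.cons (v 0) fun i : Fin (s + 2) => v i.succ) = v from Fin.cons_self_tail v] at h1
    exact h1.trans (relOrbit_add_tail (v 0) r _ fun i => I.mul_mem_left _ (hcI _))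
  have hwr : RelOrbit I w (Fin.cons b r') := by
    have h1 := relOrbit_add_head (w 0) (fun i => w i.succ) (fun i => t (.inr i) * x)
      fun i => I.mul_mem_left _ hxI
    rw [show (Fin.cons (w 0) fun i : Fin (s + 2) => w i.succ) = w from Fin.cons_self_tail w] at h1
    exact h1.trans (relOrbit_add_tail (w 0) r' _ fun i => I.mul_mem_left _ (hcI _))
  have hsub : a - b = 1 - z * f := by
    simp only [a, b, mul_assoc, ← Finset.mul_sum]
    linear_combination z * hc + z * hef + hz
  have ha1 : a - 1 ∈ I := by
    have : a - 1 = (v 0 - 1) + ∑ i, z * c (.inl i) * r i := by simp only [a]; ring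
    rw [this]
    exact add_mem hv0 (sum_mem fun i _ => I.mul_mem_left _ (hr i))
  have hab : IsCoprime a b := by
    rw [← Ideal.isCoprime_span_singleton_iff, Ideal.isCoprime_iff_sup_eq]
    by_contra hne
    obtain ⟨M, hM, hle⟩ := Ideal.exists_le_maximal _ hne
    have haM : a ∈ M := hle (Ideal.mem_sup_left (Ideal.mem_span_singleton_self a))
    have hbM : b ∈ M := hle (Ideal.mem_sup_right (Ideal.mem_span_singleton_self b))
    refine hM.ne_top ((Ideal.eq_top_iff_one _).mpr ?_)
    have hmem : (⟨M, hM⟩ : MaximalSpectrum R) ∈ {m : MaximalSpectrum R | I ≤ m.asIdeal} ∪ Y :=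
      hcover ▸ Set.mem_univ _
    rcases hmem with hI | hMY
    · have : (1 : R) = a - (a - 1) := by ring
      exact this ▸ sub_mem haM (hI ha1)
    · have : (1 : R) = a - b + z * f := by rw [hsub]; ring
      exact this ▸ add_mem (sub_mem haM hbM) (M.mul_mem_left _ (hJle _ hMY hfJ))
  obtain ⟨p, hap, hbp⟩ := exists_relOrbit_of_isCoprime hab hr hr'
  obtain ⟨ε₁, hε₁, h₁⟩ := hvr.trans hap
  obtain ⟨ε₂, hε₂, h₂⟩ := hwr.trans hbp
  refine ⟨ε₁, hε₁, ε₂, hε₂, b, ?_⟩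
  rw [h₁, h₂, Fin.update_cons_zero]
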